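/- arXiv:2510.04455 — 4 statements merged into one kernel-verified Lean document; each statement's English description precedes it below -/
import Mathlib

section
/- Let X and 𝒮 be nonempty sets, f : X × 𝒮 → ℝ^D, θ ∈ ℝ^D, let Φ ⊆ ℝ^{d_Φ} be a lattice, and let g : X × Φ × 𝒮 → ℝ^J be such that for every x ∈ X and s ∈ 𝒮 the map g(x, ·, s) : Φ → ℝ^J is a lattice homomorphism. Fix s ∈ 𝒮, parameters φ^true, φ^sup ∈ Φ with φ^true ≤ φ^sup, and a point x̂ ∈ X with g(x̂, φ^sup, s) ≤ 0. If x̂ ∈ FOP(θ, φ^true, s), then x̂ ∈ FOP(θ, φ^sup, s). -/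
/-- **Enlarging the feasible set via the supremal parameter preserves optimality of a
given point.**  If `g x̂ φsup s ≤ 0` and `x̂ ∈ FOP (θ, φtrue, s)` with `φtrue ≤ φsup`,
where `g (x, ·, s)` is a lattice homomorphism on the lattice `Φ` for all `x, s`,
then `x̂ ∈ FOP (θ, φsup, s)`. -/
theorem stmt7 (k D dΦ J : ℕ) (S : Type*) [Nonempty S]
    (X : Set (Fin k → ℝ)) (hX : X.Nonempty)
    (f : (Fin k → ℝ) → S → Fin D → ℝ) (θ : Fin D → ℝ)
    (Φ : Set (Fin dΦ → ℝ))
    (hlat : ∀ φ ∈ Φ, ∀ φ' ∈ Φ, φ ⊔ φ' ∈ Φ ∧ φ ⊓ φ' ∈ Φ)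
    (g : (Fin k → ℝ) → (Fin dΦ → ℝ) → S → Fin J → ℝ)
    (hhom : ∀ (x : Fin k → ℝ) (s : S), ∀ φ ∈ Φ, ∀ φ' ∈ Φ,
        g x (φ ⊓ φ') s = g x φ s ⊓ g x φ' s ∧ g x (φ ⊔ φ') s = g x φ s ⊔ g x φ' s)
    (s : S) (φtrue φsup : Fin dΦ → ℝ) (hφtrue : φtrue ∈ Φ) (hφsup : φsup ∈ Φ)
    (hle : φtrue ≤ φsup)
    (xh : Fin k → ℝ) (hxhX : xh ∈ X) (hfeas : g xh φsup s ≤ 0)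
    (hFOPtrue : xh ∈ X ∧ g xh φtrue s ≤ 0 ∧
      ∀ x' ∈ X, g x' φtrue s ≤ 0 → ∑ i, θ i * f x' s i ≤ ∑ i, θ i * f xh s i) :
    xh ∈ X ∧ g xh φsup s ≤ 0 ∧
      ∀ x' ∈ X, g x' φsup s ≤ 0 → ∑ i, θ i * f x' s i ≤ ∑ i, θ i * f xh s i := by
  refine ⟨hxhX, hfeas, fun x' hx' hg => hFOPtrue.2.2 x' hx' (le_trans ?_ hg)⟩
  have h := (hhom x' s φtrue hφtrue φsup hφsup).2
  rw [sup_eq_right.mpr hle] at h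
  exact sup_eq_right.mp h.symm
end

section
/- Let X ⊆ ℝ^k, 𝒮 a nonempty set, and f : X × 𝒮 → ℝ^D with ‖f(x, s) − f(x', s)‖₂ ≤ L_f ‖x − x'‖₂ for all s ∈ 𝒮 and x, x' ∈ X. Let Φ ⊆ ℝ^{d_Φ} be a lattice and g : X × Φ × 𝒮 → ℝ^J be such that g(x, ·, s) : Φ → ℝ^J is a lattice homomorphism for every x, s. Fix s ∈ 𝒮 and φ^true ∈ Φ, and let x̂ ∈ X satisfy g(x̂, φ^true, s) ≤ 0. Then for all θ, θ' ∈ ℝ^D with ‖θ‖₂ ≤ 1 and ‖θ'‖₂ ≤ 1, and all φ, φ' ∈ Φ with φ ≥ φ^true and φ' ≥ φ^true such that the feasible sets X(φ, s), X(φ', s), X(φ^true, s) are nonempty and compact: | ℓ^{sub,0}(x̂, θ, φ, s) − ℓ^{sub,0}(x̂, θ', φ', s) | ≤ L_f · d^H(X(φ, s), X(φ', s)) + L_f · d^H(X(φ^true, s), {x̂}) · ‖θ − θ'‖₂, where d^H denotes the Hausdorff distance with respect to the Euclidean metric on ℝ^k. -/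
open MeasureTheory

/-- One-sided Lipschitz estimate for the support value `sup_{x ∈ A} ⟪θ, f x⟫` in `(θ, A)`. -/
lemma sSup_inner_image_sub_le {E F : Type*} [SeminormedAddCommGroup E]
    [NormedAddCommGroup F] [InnerProductSpace ℝ F]
    {f : E → F} {L : ℝ} (hL : 0 ≤ L) {A B T : Set E} {z : E}
    (hLip : ∀ x ∈ T, ∀ y ∈ T, ‖f x - f y‖ ≤ L * ‖x - y‖)
    (hAT : A ⊆ T) (hBT : B ⊆ T) (hz : z ∈ T) (hA : A.Nonempty) (hB : B.Nonempty)
    (hAc : IsCompact A) (hBc : IsCompact B) (hTc : IsCompact T)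
    {θ θ' : F} (hθ : ‖θ‖ ≤ 1) :
    sSup ((fun x => inner ℝ θ (f x)) '' A) - inner ℝ θ (f z)
      - (sSup ((fun x => inner ℝ θ' (f x)) '' B) - inner ℝ θ' (f z)) ≤
      L * Metric.hausdorffDist A B + L * Metric.hausdorffDist T {z} * ‖θ - θ'‖ := by
  have hzdist : ∀ y ∈ T, ‖f y - f z‖ ≤ L * Metric.hausdorffDist T {z} := by
    intro y hy
    have h := Metric.infDist_le_hausdorffDist_of_mem hy
      (Metric.hausdorffEDist_ne_top_of_nonempty_of_bounded ⟨z, hz⟩ (Set.singleton_nonempty z)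
        hTc.isBounded Bornology.isBounded_singleton)
    rw [Metric.infDist_singleton, dist_eq_norm] at h
    exact (hLip y hy z hz).trans (mul_le_mul_of_nonneg_left h hL)
  have hbdd : BddAbove ((fun x => inner ℝ θ' (f x)) '' B) := by
    refine ⟨‖θ'‖ * (L * Metric.hausdorffDist T {z}) + inner ℝ θ' (f z), ?_⟩
    rintro _ ⟨y, hy, rfl⟩
    have h := (real_inner_le_norm θ' (f y - f z)).trans
      (mul_le_mul_of_nonneg_left (hzdist y (hBT hy)) (norm_nonneg θ'))
    rw [inner_sub_right] at h
    dsimp only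
    linarith
  suffices h : sSup ((fun x => inner ℝ θ (f x)) '' A) ≤
      inner ℝ θ (f z) + (sSup ((fun x => inner ℝ θ' (f x)) '' B) - inner ℝ θ' (f z)) +
        (L * Metric.hausdorffDist A B + L * Metric.hausdorffDist T {z} * ‖θ - θ'‖) by
    linarith
  refine csSup_le (hA.image _) ?_
  rintro _ ⟨x, hx, rfl⟩
  obtain ⟨y, hy, hxy⟩ := hBc.exists_infDist_eq_dist hB x
  have hd := Metric.infDist_le_hausdorffDist_of_mem hx
    (Metric.hausdorffEDist_ne_top_of_nonempty_of_bounded hA hB hAc.isBounded hBc.isBounded)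
  rw [hxy, dist_eq_norm] at hd
  have hshift : inner ℝ θ (f x - f y) ≤ L * Metric.hausdorffDist A B :=
    calc inner ℝ θ (f x - f y) ≤ ‖θ‖ * ‖f x - f y‖ := real_inner_le_norm _ _
      _ ≤ ‖f x - f y‖ := mul_le_of_le_one_left (norm_nonneg _) hθ
      _ ≤ L * ‖x - y‖ := hLip x (hAT hx) y (hBT hy)
      _ ≤ L * Metric.hausdorffDist A B := mul_le_mul_of_nonneg_left hd hL
  have hrot : inner ℝ (θ - θ') (f y - f z) ≤ L * Metric.hausdorffDist T {z} * ‖θ - θ'‖ := by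
    rw [mul_comm _ ‖θ - θ'‖]
    exact (real_inner_le_norm _ _).trans
      (mul_le_mul_of_nonneg_left (hzdist y (hBT hy)) (norm_nonneg _))
  have hsup := le_csSup hbdd (Set.mem_image_of_mem _ hy)
  simp only [inner_sub_left, inner_sub_right] at hshift hrot
  dsimp only at hsup ⊢
  linarith

/-- **Lipschitz property of the suboptimality loss `ℓ^{sub,0}` in `(θ, φ)`.**
With `f(·,s)` `L_f`-Lipschitz, `g(x,·,s)` a lattice homomorphism on the lattice `Φ`,
`x̂` feasible for `φtrue`, and `φ, φ' ≥ φtrue` with nonempty compact feasible sets,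
`|ℓ^{sub,0}(x̂,θ,φ,s) − ℓ^{sub,0}(x̂,θ',φ',s)|
  ≤ L_f d^H(X(φ,s), X(φ',s)) + L_f d^H(X(φtrue,s), {x̂}) ‖θ − θ'‖`. -/
theorem stmt11 (k D dΦ J : ℕ) (S : Type*) [Nonempty S]
    (X : Set (EuclideanSpace ℝ (Fin k)))
    (f : EuclideanSpace ℝ (Fin k) → S → EuclideanSpace ℝ (Fin D))
    (Lf : ℝ)
    (hLip : ∀ (s : S), ∀ x ∈ X, ∀ x' ∈ X, ‖f x s - f x' s‖ ≤ Lf * ‖x - x'‖)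
    (Φ : Set (Fin dΦ → ℝ))
    (hlat : ∀ φ ∈ Φ, ∀ φ' ∈ Φ, φ ⊔ φ' ∈ Φ ∧ φ ⊓ φ' ∈ Φ)
    (g : EuclideanSpace ℝ (Fin k) → (Fin dΦ → ℝ) → S → Fin J → ℝ)
    (hhom : ∀ (x : EuclideanSpace ℝ (Fin k)) (s : S), ∀ φ ∈ Φ, ∀ φ' ∈ Φ,
        g x (φ ⊓ φ') s = g x φ s ⊓ g x φ' s ∧ g x (φ ⊔ φ') s = g x φ s ⊔ g x φ' s)
    (s : S) (φtrue : Fin dΦ → ℝ) (hφtrue : φtrue ∈ Φ)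
    (xh : EuclideanSpace ℝ (Fin k)) (hxhX : xh ∈ X) (hxhfeas : g xh φtrue s ≤ 0)
    (Xf : (Fin dΦ → ℝ) → Set (EuclideanSpace ℝ (Fin k)))
    (hXf : ∀ φ, Xf φ = {x ∈ X | g x φ s ≤ 0})
    (ℓ : EuclideanSpace ℝ (Fin D) → (Fin dΦ → ℝ) → ℝ)
    (hℓ : ∀ θ φ, ℓ θ φ =
      max (sSup ((fun x => ∑ i, θ i * f x s i) '' Xf φ) - ∑ i, θ i * f xh s i) 0) :
    ∀ θ θ' : EuclideanSpace ℝ (Fin D), ‖θ‖ ≤ 1 → ‖θ'‖ ≤ 1 →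
      ∀ φ ∈ Φ, ∀ φ' ∈ Φ, φtrue ≤ φ → φtrue ≤ φ' →
      (Xf φ).Nonempty → IsCompact (Xf φ) →
      (Xf φ').Nonempty → IsCompact (Xf φ') →
      (Xf φtrue).Nonempty → IsCompact (Xf φtrue) →
      |ℓ θ φ - ℓ θ' φ'| ≤
        Lf * Metric.hausdorffDist (Xf φ) (Xf φ') +
          Lf * Metric.hausdorffDist (Xf φtrue) {xh} * ‖θ - θ'‖ := by
  intro θ θ' hθ hθ' φ hφ φ' hφ' hle hle' hne hc hne' hc' hneT hcT
  have hsub : ∀ ψ ∈ Φ, φtrue ≤ ψ → Xf ψ ⊆ Xf φtrue := by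
    intro ψ hψ h x hx
    rw [hXf] at hx ⊢
    refine ⟨hx.1, le_trans ?_ hx.2⟩
    have hg := (hhom x s φtrue hφtrue ψ hψ).1
    rw [inf_eq_left.mpr h] at hg
    exact inf_eq_left.mp hg.symm
  have hX : ∀ ψ, Xf ψ ⊆ X := fun ψ x hx => by
    rw [hXf] at hx
    exact hx.1
  have hz : xh ∈ Xf φtrue := by
    rw [hXf]
    exact ⟨hxhX, hxhfeas⟩
  have hinner : ∀ (ϑ : EuclideanSpace ℝ (Fin D)) x, ∑ i, ϑ i * f x s i = inner ℝ ϑ (f x s) := by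
    intro ϑ x
    simp [PiLp.inner_apply, mul_comm]
  simp only [hℓ, hinner]
  rcases le_or_gt 0 Lf with hL | hL
  · have hLip' : ∀ x ∈ Xf φtrue, ∀ y ∈ Xf φtrue, ‖f x s - f y s‖ ≤ Lf * ‖x - y‖ :=
      fun x hx y hy => hLip s x (hX _ hx) y (hX _ hy)
    refine (abs_max_sub_max_le_abs _ _ _).trans (abs_le.mpr ⟨?_, ?_⟩)
    · have h := sSup_inner_image_sub_le (f := fun x => f x s) hL hLip' (hsub φ' hφ' hle')
        (hsub φ hφ hle) hz hne' hne hc' hc hcT (θ' := θ) hθ'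
      rw [Metric.hausdorffDist_comm, norm_sub_rev] at h
      linarith
    · exact sSup_inner_image_sub_le (f := fun x => f x s) hL hLip' (hsub φ hφ hle)
        (hsub φ' hφ' hle') hz hne hne' hc hc' hcT hθ
  · have hXsub : X ⊆ {xh} := by
      intro x hx
      by_contra hne
      have hpos : 0 < ‖x - xh‖ := norm_pos_iff.mpr (sub_ne_zero.mpr hne)
      have h := hLip s x hx xh hxhX
      nlinarith [norm_nonneg (f x s - f xh s)]
    have hsing : ∀ ψ, (Xf ψ).Nonempty → Xf ψ = {xh} := fun ψ h =>
      h.subset_singleton_iff.mp ((hX ψ).trans hXsub)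
    simp [hsing φ hne, hsing φ' hne', hsing φtrue hneT]
end

section
/- Let λ ≥ 0. Let X ⊆ ℝ^k, 𝒮 a nonempty set, and f : X × 𝒮 → ℝ^D with ‖f(x, s) − f(x', s)‖₂ ≤ L_f ‖x − x'‖₂ for all s ∈ 𝒮 and x, x' ∈ X. Let Φ ⊆ ℝ^{d_Φ} be a lattice and g : X × Φ × 𝒮 → ℝ^J be such that g(x, ·, s) : Φ → ℝ^J is a lattice homomorphism for every x, s. Fix s ∈ 𝒮 and φ^true ∈ Φ, and let x̂ ∈ X satisfy g(x̂, φ^true, s) ≤ 0. Then for all θ, θ' ∈ ℝ^D with ‖θ‖₂ ≤ 1 and ‖θ'‖₂ ≤ 1, and all φ, φ' ∈ Φ with φ ≥ φ^true and φ' ≥ φ^true such that g(x̂, φ, s) ≤ 0, g(x̂, φ', s) ≤ 0, and the feasible sets X(φ, s), X(φ', s), X(φ^true, s) are nonempty and compact: | ℓ^{sub,λ}(x̂, θ, φ, s) − ℓ^{sub,λ}(x̂, θ', φ', s) | ≤ L_f · d^H(X(φ, s), X(φ', s)) + L_f · d^H(X(φ^true, s), {x̂}) · ‖θ − θ'‖₂,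 where d^H denotes the Hausdorff distance with respect to the Euclidean metric on ℝ^k. -/
open MeasureTheory

section SupportFunction

variable {E F : Type*} [SeminormedAddCommGroup E] [NormedAddCommGroup F] [InnerProductSpace ℝ F]

/-- The distance from a point of a bounded set `C` to `p` is at most `d^H(C, {p})`. -/
theorem dist_le_hausdorffDist_singleton {C : Set E} (hC : Bornology.IsBounded C) {x p : E}
    (hx : x ∈ C) : dist x p ≤ Metric.hausdorffDist C {p} := by
  have h := Metric.infDist_le_hausdorffDist_of_mem hx
    (Metric.hausdorffEDist_ne_top_of_nonempty_of_bounded ⟨x, hx⟩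
      (Set.singleton_nonempty p) hC Bornology.isBounded_singleton)
  rwa [Metric.infDist_singleton] at h

theorem bddAbove_inner_image {X B C : Set E} {f : E → F} {L : ℝ} (hL : 0 ≤ L)
    (hf : ∀ x ∈ X, ∀ y ∈ X, ‖f x - f y‖ ≤ L * ‖x - y‖) (hCX : C ⊆ X)
    (hC : Bornology.IsBounded C) (hBC : B ⊆ C) {p : E} (hp : p ∈ X) (θ : F) :
    BddAbove ((fun x => inner ℝ θ (f x)) '' B) := by
  refine ⟨inner ℝ θ (f p) + ‖θ‖ * (L * Metric.hausdorffDist C {p}), ?_⟩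
  rintro _ ⟨x, hx, rfl⟩
  have h₁ := dist_le_hausdorffDist_singleton (p := p) hC (hBC hx)
  rw [dist_eq_norm] at h₁
  have h₂ : inner ℝ θ (f x - f p) ≤ ‖θ‖ * (L * Metric.hausdorffDist C {p}) :=
    (real_inner_le_norm _ _).trans (by
      gcongr
      exact (hf x (hCX (hBC hx)) p hp).trans (by gcongr))
  rw [inner_sub_right] at h₂
  change inner ℝ θ (f x) ≤ _
  linarith

/-- Variation of the support function of `f '' A`, normalized at `p`, when both the direction
and the set change. -/
theorem sSup_inner_sub_le_add {X A B C : Set E} {f : E → F} {L : ℝ} (hL : 0 ≤ L)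
    (hf : ∀ x ∈ X, ∀ y ∈ X, ‖f x - f y‖ ≤ L * ‖x - y‖) (hCX : C ⊆ X)
    (hC : Bornology.IsBounded C) (hAC : A ⊆ C) (hBC : B ⊆ C) (hA : A.Nonempty)
    (hB : IsCompact B) (hBne : B.Nonempty) {p : E} (hp : p ∈ X) {θ θ' : F} (hθ : ‖θ‖ ≤ 1) :
    sSup ((fun x => inner ℝ θ (f x)) '' A) - inner ℝ θ (f p) ≤
      sSup ((fun x => inner ℝ θ' (f x)) '' B) - inner ℝ θ' (f p) +
        (L * Metric.hausdorffDist A B + L * Metric.hausdorffDist C {p} * ‖θ - θ'‖) := by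
  rw [sub_le_iff_le_add]
  refine csSup_le (hA.image _) ?_
  rintro _ ⟨x, hx, rfl⟩
  obtain ⟨y, hy, hxy⟩ := hB.exists_infDist_eq_dist hBne x
  have hdist : ‖x - y‖ ≤ Metric.hausdorffDist A B := by
    rw [← dist_eq_norm, ← hxy]
    exact Metric.infDist_le_hausdorffDist_of_mem hx
      (Metric.hausdorffEDist_ne_top_of_nonempty_of_bounded hA hBne (hC.subset hAC) hB.isBounded)
  have hyp := dist_le_hausdorffDist_singleton (p := p) hC (hBC hy)
  rw [dist_eq_norm] at hyp
  have h₁ : inner ℝ θ (f x - f y) ≤ L * Metric.hausdorffDist A B :=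
    calc inner ℝ θ (f x - f y) ≤ ‖θ‖ * ‖f x - f y‖ := real_inner_le_norm _ _
      _ ≤ 1 * (L * ‖x - y‖) := by
        gcongr
        exact hf x (hCX (hAC hx)) y (hCX (hBC hy))
      _ ≤ L * Metric.hausdorffDist A B := by
        rw [one_mul]
        gcongr
  have h₂ : inner ℝ (θ - θ') (f y - f p) ≤ L * Metric.hausdorffDist C {p} * ‖θ - θ'‖ :=
    calc inner ℝ (θ - θ') (f y - f p) ≤ ‖θ - θ'‖ * ‖f y - f p‖ := real_inner_le_norm _ _
      _ ≤ ‖θ - θ'‖ * (L * Metric.hausdorffDist C {p}) := by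
        gcongr
        exact (hf y (hCX (hBC hy)) p hp).trans (by gcongr)
      _ = _ := mul_comm _ _
  have h₃ : inner ℝ θ' (f y) ≤ sSup ((fun x => inner ℝ θ' (f x)) '' B) :=
    le_csSup (bddAbove_inner_image hL hf hCX hC hBC hp θ') (Set.mem_image_of_mem _ hy)
  simp only [inner_sub_left, inner_sub_right] at h₁ h₂
  change inner ℝ θ (f x) ≤ _
  linarith

theorem abs_sSup_inner_sub_sub_le {X A B C : Set E} {f : E → F} {L : ℝ} (hL : 0 ≤ L)
    (hf : ∀ x ∈ X, ∀ y ∈ X, ‖f x - f y‖ ≤ L * ‖x - y‖) (hCX : C ⊆ X)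
    (hC : Bornology.IsBounded C) (hAC : A ⊆ C) (hBC : B ⊆ C)
    (hA : IsCompact A) (hAne : A.Nonempty) (hB : IsCompact B) (hBne : B.Nonempty)
    {p : E} (hp : p ∈ X) {θ θ' : F} (hθ : ‖θ‖ ≤ 1) (hθ' : ‖θ'‖ ≤ 1) :
    |(sSup ((fun x => inner ℝ θ (f x)) '' A) - inner ℝ θ (f p)) -
        (sSup ((fun x => inner ℝ θ' (f x)) '' B) - inner ℝ θ' (f p))| ≤
      L * Metric.hausdorffDist A B + L * Metric.hausdorffDist C {p} * ‖θ - θ'‖ := by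
  have h₁ := sSup_inner_sub_le_add hL hf hCX hC hAC hBC hAne hB hBne hp (θ' := θ') hθ
  have h₂ := sSup_inner_sub_le_add hL hf hCX hC hBC hAC hBne hA hAne hp (θ' := θ) hθ'
  rw [Metric.hausdorffDist_comm, norm_sub_rev] at h₂
  rw [abs_le]
  constructor <;> linarith

end SupportFunction

/-- **Lipschitz property of the suboptimality loss `ℓ^{sub,λ}` in `(θ, φ)`.**
With `λ ≥ 0`, `f(·,s)` `L_f`-Lipschitz, `g(x,·,s)` a lattice homomorphism on the
lattice `Φ`, `x̂` feasible for `φtrue`, and `φ, φ' ≥ φtrue` with `x̂` feasible for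
both and nonempty compact feasible sets,
`|ℓ^{sub,λ}(x̂,θ,φ,s) − ℓ^{sub,λ}(x̂,θ',φ',s)|
  ≤ L_f d^H(X(φ,s), X(φ',s)) + L_f d^H(X(φtrue,s), {x̂}) ‖θ − θ'‖`. -/
theorem stmt12 (k D dΦ J : ℕ) (S : Type*) [Nonempty S]
    (lam : ℝ) (hlam : 0 ≤ lam)
    (X : Set (EuclideanSpace ℝ (Fin k)))
    (f : EuclideanSpace ℝ (Fin k) → S → EuclideanSpace ℝ (Fin D))
    (Lf : ℝ)
    (hLip : ∀ (s : S), ∀ x ∈ X, ∀ x' ∈ X, ‖f x s - f x' s‖ ≤ Lf * ‖x - x'‖)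
    (Φ : Set (Fin dΦ → ℝ))
    (hlat : ∀ φ ∈ Φ, ∀ φ' ∈ Φ, φ ⊔ φ' ∈ Φ ∧ φ ⊓ φ' ∈ Φ)
    (g : EuclideanSpace ℝ (Fin k) → (Fin dΦ → ℝ) → S → Fin J → ℝ)
    (hhom : ∀ (x : EuclideanSpace ℝ (Fin k)) (s : S), ∀ φ ∈ Φ, ∀ φ' ∈ Φ,
        g x (φ ⊓ φ') s = g x φ s ⊓ g x φ' s ∧ g x (φ ⊔ φ') s = g x φ s ⊔ g x φ' s)
    (s : S) (φtrue : Fin dΦ → ℝ) (hφtrue : φtrue ∈ Φ)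
    (xh : EuclideanSpace ℝ (Fin k)) (hxhX : xh ∈ X) (hxhfeas : g xh φtrue s ≤ 0)
    (Xf : (Fin dΦ → ℝ) → Set (EuclideanSpace ℝ (Fin k)))
    (hXf : ∀ φ, Xf φ = {x ∈ X | g x φ s ≤ 0})
    (ℓ : EuclideanSpace ℝ (Fin D) → (Fin dΦ → ℝ) → ℝ)
    (hℓ : ∀ θ φ, ℓ θ φ =
      max (sSup ((fun x => ∑ i, θ i * f x s i) '' Xf φ) - ∑ i, θ i * f xh s i) 0
        + lam * ∑ j, max (g xh φ s j) 0) :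
    ∀ θ θ' : EuclideanSpace ℝ (Fin D), ‖θ‖ ≤ 1 → ‖θ'‖ ≤ 1 →
      ∀ φ ∈ Φ, ∀ φ' ∈ Φ, φtrue ≤ φ → φtrue ≤ φ' →
      g xh φ s ≤ 0 → g xh φ' s ≤ 0 →
      (Xf φ).Nonempty → IsCompact (Xf φ) →
      (Xf φ').Nonempty → IsCompact (Xf φ') →
      (Xf φtrue).Nonempty → IsCompact (Xf φtrue) →
      |ℓ θ φ - ℓ θ' φ'| ≤
        Lf * Metric.hausdorffDist (Xf φ) (Xf φ') +
          Lf * Metric.hausdorffDist (Xf φtrue) {xh} * ‖θ - θ'‖ := by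
  intro θ θ' hθ hθ' φ hφ φ' hφ' hle hle' hfeas hfeas' hne hc hne' hc' _ hct
  have sum_eq_inner (v w : EuclideanSpace ℝ (Fin D)) : ∑ i, v i * w i = inner ℝ v w := by
    simp [PiLp.inner_apply, mul_comm]
  have subset_true (ψ : Fin dΦ → ℝ) (hψ : ψ ∈ Φ) (h : φtrue ≤ ψ) : Xf ψ ⊆ Xf φtrue := by
    intro x hx
    rw [hXf] at hx ⊢
    have hsup := (hhom x s φtrue hφtrue ψ hψ).2
    rw [sup_eq_right.mpr h] at hsup
    exact ⟨hx.1, (le_sup_left.trans hsup.ge).trans hx.2⟩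
  have hCX : Xf φtrue ⊆ X := fun x hx => ((hXf φtrue).subset hx).1
  -- If `Lf < 0`, then `X` is a singleton and the constant may be replaced by `0`.
  obtain ⟨L, hL, hf, hmul⟩ : ∃ L, 0 ≤ L ∧ (∀ x ∈ X, ∀ y ∈ X, ‖f x s - f y s‖ ≤ L * ‖x - y‖) ∧
      ∀ A ⊆ X, A.Nonempty → ∀ B ⊆ X, B.Nonempty →
        L * Metric.hausdorffDist A B = Lf * Metric.hausdorffDist A B := by
    rcases le_or_gt 0 Lf with h | h
    · exact ⟨Lf, h, hLip s, fun _ _ _ _ _ _ => rfl⟩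
    · have hX : X.Subsingleton := by
        intro x hx y hy
        have h₁ := (norm_nonneg _).trans (hLip s x hx y hy)
        have h₂ : ‖x - y‖ ≤ 0 := nonpos_of_mul_nonneg_right h₁ h
        exact sub_eq_zero.mp (norm_le_zero_iff.mp h₂)
      refine ⟨0, le_rfl, fun x hx y hy => by simp [hX hx hy], ?_⟩
      intro A hAX hA B hBX hB
      have hAB : A = B := by
        obtain ⟨a, ha⟩ := hA
        obtain ⟨b, hb⟩ := hB
        rw [(hX.anti hAX).eq_singleton_of_mem ha, (hX.anti hBX).eq_singleton_of_mem hb,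
          hX (hAX ha) (hBX hb)]
      simp [hAB]
  have hA := subset_true φ hφ hle
  have hB := subset_true φ' hφ' hle'
  have loss_eq (η : EuclideanSpace ℝ (Fin D)) (ψ : Fin dΦ → ℝ) (hψ : Xf ψ ⊆ Xf φtrue)
      (hx : g xh ψ s ≤ 0) :
      ℓ η ψ = sSup ((fun x => inner ℝ η (f x s)) '' Xf ψ) - inner ℝ η (f xh s) := by
    have hmem : xh ∈ Xf ψ := by
      rw [hXf]
      exact ⟨hxhX, hx⟩
    have hsum : ∑ j, max (g xh ψ s j) 0 = 0 :=
      Finset.sum_eq_zero fun j _ => max_eq_right (hx j)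
    simp only [hℓ, sum_eq_inner, hsum, mul_zero, add_zero]
    refine max_eq_left (sub_nonneg.mpr ?_)
    exact le_csSup (bddAbove_inner_image (f := fun x => f x s) hL hf hCX hct.isBounded hψ hxhX η)
      (Set.mem_image_of_mem _ hmem)
  rw [loss_eq θ φ hA hfeas, loss_eq θ' φ' hB hfeas',
    ← hmul _ (hA.trans hCX) hne _ (hB.trans hCX) hne',
    ← hmul _ hCX (hne.mono hA) _ (Set.singleton_subset_iff.mpr hxhX) (Set.singleton_nonempty xh)]
  exact abs_sSup_inner_sub_sub_le (f := fun x => f x s) hL hf hCX hct.isBounded hA hB hc hne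
    hc' hne' hxhX hθ hθ'
end

section
/- Let (Θ₁, d₁) and (Θ₂, d₂) be pseudometric spaces, and equip Θ₁ × Θ₂ with the pseudometric d₁₂((θ₁, θ₂), (θ₁', θ₂')) := d₁(θ₁, θ₁') + d₂(θ₂, θ₂'). Let p₁, p₂ > 0 with p₁ + p₂ = 1. Then ∫₀^∞ √( log N(Θ₁ × Θ₂, d₁₂, ε) ) dε ≤ (1/p₁) ∫₀^∞ √( log N(Θ₁, d₁, ε) ) dε + (1/p₂) ∫₀^∞ √( log N(Θ₂, d₂, ε) ) dε. -/
open ENNReal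

/-- The `ε`-covering number of the space `Θ` with respect to the pseudometric `d`. -/
noncomputable def covN {Θ : Type*} (d : Θ → Θ → ℝ) (ε : ℝ) : ℝ≥0∞ :=
  sInf {n : ℝ≥0∞ | ∃ F : Finset Θ, (F.card : ℝ≥0∞) = n ∧ ∀ θ : Θ, ∃ c ∈ F, d θ c < ε}

/-- `√(log n)`, as a map `ℝ≥0∞ → ℝ≥0∞`. -/
noncomputable def sqrtLog (n : ℝ≥0∞) : ℝ≥0∞ :=
  if n = ⊤ then ⊤ else ENNReal.ofReal (Real.sqrt (Real.log n.toReal))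

/-- Dudley's entropy integral `∫₀^∞ √(log N(Θ,d,ε)) dε`. -/
noncomputable def entInt {Θ : Type*} (d : Θ → Θ → ℝ) : ℝ≥0∞ :=
  ∫⁻ ε in Set.Ioi (0 : ℝ), sqrtLog (covN d ε)

theorem covN_le_card {Θ : Type*} {d : Θ → Θ → ℝ} {ε : ℝ} {F : Finset Θ}
    (hF : ∀ θ : Θ, ∃ c ∈ F, d θ c < ε) : covN d ε ≤ F.card :=
  sInf_le ⟨F, rfl, hF⟩

/-- A finite covering number is attained by some finite cover. -/
theorem exists_cover_card_eq_covN {Θ : Type*} {d : Θ → Θ → ℝ} {ε : ℝ} (h : covN d ε ≠ ⊤) :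
    ∃ F : Finset Θ, (F.card : ℝ≥0∞) = covN d ε ∧ ∀ θ : Θ, ∃ c ∈ F, d θ c < ε := by
  have hne : {F : Finset Θ | ∀ θ : Θ, ∃ c ∈ F, d θ c < ε}.Nonempty := by
    by_contra hempty
    refine h (sInf_eq_top.2 ?_)
    rintro _ ⟨F, -, hF⟩
    exact absurd ⟨F, hF⟩ hempty
  obtain ⟨F, hF, hmin⟩ := exists_minimalFor_of_wellFoundedLT
    (fun F : Finset Θ => ∀ θ : Θ, ∃ c ∈ F, d θ c < ε) Finset.card hne
  refine ⟨F, le_antisymm (le_sInf ?_) (covN_le_card hF), hF⟩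
  rintro _ ⟨G, rfl, hG⟩
  rcases le_total F.card G.card with hle | hle
  · exact_mod_cast hle
  · exact_mod_cast hmin hG hle

theorem covN_antitone {Θ : Type*} (d : Θ → Θ → ℝ) : Antitone (covN d) := by
  intro ε δ h
  refine le_sInf ?_
  rintro _ ⟨F, rfl, hF⟩
  refine covN_le_card fun θ => ?_
  obtain ⟨c, hc, hlt⟩ := hF θ
  exact ⟨c, hc, hlt.trans_le h⟩

theorem covN_of_isEmpty {Θ : Type*} [IsEmpty Θ] (d : Θ → Θ → ℝ) (ε : ℝ) : covN d ε = 0 := by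
  simpa using covN_le_card (d := d) (ε := ε) (F := ∅) isEmptyElim

theorem covN_ne_zero {Θ : Type*} [Nonempty Θ] (d : Θ → Θ → ℝ) (ε : ℝ) : covN d ε ≠ 0 := by
  intro h
  obtain ⟨F, hcard, hF⟩ := exists_cover_card_eq_covN (d := d) (ε := ε) (by simp [h])
  obtain ⟨c, hc, -⟩ := hF (Classical.arbitrary Θ)
  rw [h, Nat.cast_eq_zero, Finset.card_eq_zero] at hcard
  simp [hcard] at hc

theorem covN_prod_le {Θ₁ Θ₂ : Type*} (d₁ : Θ₁ → Θ₁ → ℝ) (d₂ : Θ₂ → Θ₂ → ℝ) (ε₁ ε₂ : ℝ) :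
    covN (fun a b : Θ₁ × Θ₂ => d₁ a.1 b.1 + d₂ a.2 b.2) (ε₁ + ε₂) ≤
      covN d₁ ε₁ * covN d₂ ε₂ := by
  rcases isEmpty_or_nonempty Θ₁ with _ | _
  · simp [covN_of_isEmpty]
  rcases isEmpty_or_nonempty Θ₂ with _ | _
  · simp [covN_of_isEmpty]
  by_cases h₁ : covN d₁ ε₁ = ⊤
  · simp [h₁, ENNReal.top_mul (covN_ne_zero d₂ ε₂)]
  by_cases h₂ : covN d₂ ε₂ = ⊤
  · simp [h₂, ENNReal.mul_top (covN_ne_zero d₁ ε₁)]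
  obtain ⟨F, hFcard, hF⟩ := exists_cover_card_eq_covN h₁
  obtain ⟨G, hGcard, hG⟩ := exists_cover_card_eq_covN h₂
  rw [← hFcard, ← hGcard, ← Nat.cast_mul, ← Finset.card_product]
  refine covN_le_card fun θ => ?_
  obtain ⟨a, ha, hda⟩ := hF θ.1
  obtain ⟨b, hb, hdb⟩ := hG θ.2
  exact ⟨(a, b), Finset.mk_mem_product ha hb, add_lt_add hda hdb⟩

theorem sqrtLog_mono : Monotone sqrtLog := by
  intro m n h
  by_cases hn : n = ⊤
  · simp [sqrtLog, hn]
  have hm : m ≠ ⊤ := ne_top_of_le_ne_top hn h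
  rcases eq_or_ne m 0 with rfl | hm0
  · simp [sqrtLog]
  simp only [sqrtLog, hm, hn, if_false]
  exact ENNReal.ofReal_le_ofReal (Real.sqrt_le_sqrt
    (Real.log_le_log (ENNReal.toReal_pos hm0 hm) (ENNReal.toReal_mono hn h)))

theorem sqrt_add_le_sqrt_add_sqrt (x y : ℝ) : √(x + y) ≤ √x + √y := by
  have le_sq_sqrt : ∀ z : ℝ, z ≤ √z ^ 2 := fun z =>
    (Real.sqrt_le_left (Real.sqrt_nonneg z)).1 le_rfl
  rw [Real.sqrt_le_left (by positivity)]
  nlinarith [le_sq_sqrt x, le_sq_sqrt y, mul_nonneg (Real.sqrt_nonneg x) (Real.sqrt_nonneg y)]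

theorem sqrtLog_mul_le (m n : ℝ≥0∞) : sqrtLog (m * n) ≤ sqrtLog m + sqrtLog n := by
  by_cases hm : m = ⊤
  · simp [sqrtLog, hm]
  by_cases hn : n = ⊤
  · simp [sqrtLog, hn]
  rcases eq_or_ne m 0 with rfl | hm0
  · simp [sqrtLog]
  rcases eq_or_ne n 0 with rfl | hn0
  · simp [sqrtLog]
  simp only [sqrtLog, hm, hn, ENNReal.mul_ne_top hm hn, if_false]
  rw [← ENNReal.ofReal_add (Real.sqrt_nonneg _) (Real.sqrt_nonneg _), ENNReal.toReal_mul,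
    Real.log_mul (ENNReal.toReal_pos hm0 hm).ne' (ENNReal.toReal_pos hn0 hn).ne']
  exact ENNReal.ofReal_le_ofReal (sqrt_add_le_sqrt_add_sqrt _ _)

theorem measurable_sqrtLog_covN {Θ : Type*} (d : Θ → Θ → ℝ) :
    Measurable fun ε => sqrtLog (covN d ε) :=
  (sqrtLog_mono.comp_antitone (covN_antitone d)).measurable

theorem lintegral_Ioi_comp_mul_left {f : ℝ → ℝ≥0∞} (hf : Measurable f) {p : ℝ} (hp : 0 < p) :
    ∫⁻ x in Set.Ioi (0 : ℝ), f (p * x) =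
      ENNReal.ofReal (1 / p) * ∫⁻ x in Set.Ioi (0 : ℝ), f x := by
  have hpre : (fun x => p * x) ⁻¹' Set.Ioi (0 : ℝ) = Set.Ioi 0 := by
    ext x
    simp [hp]
  have hmap := MeasureTheory.setLIntegral_map (μ := MeasureTheory.volume)
    (measurableSet_Ioi (a := (0 : ℝ))) hf (measurable_const_mul p)
  rw [hpre, Real.map_volume_mul_left hp.ne', MeasureTheory.Measure.restrict_smul,
    MeasureTheory.lintegral_smul_measure, abs_of_pos (inv_pos.2 hp)] at hmap
  rw [← hmap, one_div, smul_eq_mul]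

/-- **Entropy integral of a product of pseudometric spaces.**
For the sum pseudometric `d₁₂` and `p₁, p₂ > 0` with `p₁ + p₂ = 1`,
`∫₀^∞ √(log N(Θ₁×Θ₂, d₁₂, ε)) dε
  ≤ (1/p₁)∫₀^∞ √(log N(Θ₁, d₁, ε)) dε + (1/p₂)∫₀^∞ √(log N(Θ₂, d₂, ε)) dε`. -/
theorem stmt18 {Θ₁ Θ₂ : Type*}
    (d₁ : Θ₁ → Θ₁ → ℝ) (d₂ : Θ₂ → Θ₂ → ℝ)
    (hd₁_nonneg : ∀ a b, 0 ≤ d₁ a b) (hd₁_refl : ∀ a, d₁ a a = 0)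
    (hd₁_symm : ∀ a b, d₁ a b = d₁ b a) (hd₁_tri : ∀ a b c, d₁ a c ≤ d₁ a b + d₁ b c)
    (hd₂_nonneg : ∀ a b, 0 ≤ d₂ a b) (hd₂_refl : ∀ a, d₂ a a = 0)
    (hd₂_symm : ∀ a b, d₂ a b = d₂ b a) (hd₂_tri : ∀ a b c, d₂ a c ≤ d₂ a b + d₂ b c)
    (p₁ p₂ : ℝ) (hp₁ : 0 < p₁) (hp₂ : 0 < p₂) (hsum : p₁ + p₂ = 1) :
    entInt (fun (a b : Θ₁ × Θ₂) => d₁ a.1 b.1 + d₂ a.2 b.2) ≤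
      ENNReal.ofReal (1 / p₁) * entInt d₁ + ENNReal.ofReal (1 / p₂) * entInt d₂ := by
  have hpoint : ∀ ε : ℝ, sqrtLog (covN (fun a b : Θ₁ × Θ₂ => d₁ a.1 b.1 + d₂ a.2 b.2) ε) ≤
      sqrtLog (covN d₁ (p₁ * ε)) + sqrtLog (covN d₂ (p₂ * ε)) := by
    intro ε
    have hcov := covN_prod_le d₁ d₂ (p₁ * ε) (p₂ * ε)
    rw [← add_mul, hsum, one_mul] at hcov
    exact (sqrtLog_mono hcov).trans (sqrtLog_mul_le _ _)
  have hmeas : Measurable fun ε => sqrtLog (covN d₁ (p₁ * ε)) :=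
    (measurable_sqrtLog_covN d₁).comp (measurable_const_mul p₁)
  unfold entInt
  rw [← lintegral_Ioi_comp_mul_left (measurable_sqrtLog_covN d₁) hp₁,
    ← lintegral_Ioi_comp_mul_left (measurable_sqrtLog_covN d₂) hp₂,
    ← MeasureTheory.lintegral_add_left hmeas]
  exact MeasureTheory.lintegral_mono hpoint
end
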